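/- Let P* be a probability measure on [0,1]^d, absolutely continuous with respect to Lebesgue measure, with finite differential entropy. Let (ψ_m)_{m≥1} be a sequence of bounded continuous vector-valued functions on [0,1]^d, each with first coordinate the constant 1, such that every coordinate function of ψ_m is also a coordinate function of ψ_{m+1}, and the union over m of the linear spans of the coordinate functions of ψ_m is dense in the space C([0,1]^d) of continuous real-valued functions on [0,1]^d for the supremum norm. For each m, let H_m := sup h(Q) over absolutely continuous probability measures Q on [0,1]^d satisfying E_Q[ψ_m] = E_{P*}[ψ_m]. Then H_m → h(P*) as m → ∞. -/

import Mathlib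

open MeasureTheory Real Set Filter

noncomputable section
open scoped Classical

/-- The unit cube `[0,1]^d`. -/
def Cube (d : ℕ) : Set (Fin d → ℝ) := Set.univ.pi fun _ => Set.Icc (0:ℝ) 1

/-- The uniform distribution on `[0,1]`. -/
def unif01 : Measure ℝ := volume.restrict (Set.Icc (0:ℝ) 1)

/-- A copula distribution on `[0,1]^d`: a probability measure supported on the cube,
absolutely continuous w.r.t. Lebesgue measure, with uniform one-dimensional marginals. -/
structure IsCopula {d : ℕ} (P : Measure (Fin d → ℝ)) : Prop where
  prob : IsProbabilityMeasure P
  ac : P ≪ volume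
  mass : P (Cube d) = 1
  marg : ∀ i : Fin d, P.map (fun u => u i) = unif01

/-- Lebesgue density of a measure. -/
def dens {α : Type*} [MeasureSpace α] (P : Measure α) : α → ℝ :=
  fun x => (P.rnDeriv volume x).toReal

/-- Differential entropy `-∫ p log p` (w.r.t. Lebesgue measure). -/
def diffEnt {α : Type*} [MeasureSpace α] (P : Measure α) : ℝ :=
  - ∫ x, dens P x * Real.log (dens P x)

/-- The differential entropy of `P` exists and is finite. -/
def FiniteEnt {α : Type*} [MeasureSpace α] (P : Measure α) : Prop :=
  Integrable (fun x => dens P x * Real.log (dens P x))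

lemma measurableSet_cube (d : ℕ) : MeasurableSet (Cube d) :=
  MeasurableSet.univ_pi fun _ => measurableSet_Icc

lemma volume_cube (d : ℕ) : volume (Cube d) = 1 := by
  rw [Cube, volume_pi_pi]
  simp

lemma volume_cube_lt_top (d : ℕ) : volume (Cube d) < ⊤ := by
  simp [volume_cube]

/-- Young's inequality for the conjugate pair `t log t`, `exp`. -/
lemma mul_log_sub_mul_log_le {t s : ℝ} (ht : 0 ≤ t) (hs : 0 < s) :
    t * log s - t * log t ≤ s - t := by
  rcases ht.eq_or_lt with rfl | ht
  · simpa using hs.le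
  · have h := mul_le_mul_of_nonneg_left (log_le_sub_one_of_pos (div_pos hs ht)) ht.le
    rw [log_div hs.ne' ht.ne'] at h
    have h' : t * (s / t - 1) = s - t := by field_simp
    linarith

lemma abs_log_sub_log_le {a x y : ℝ} (ha : 0 < a) (hx : a ≤ x) (hy : a ≤ y) :
    |log x - log y| ≤ |x - y| / a := by
  wlog h : y ≤ x generalizing x y
  · rw [abs_sub_comm, abs_sub_comm x y]
    exact this hy hx (not_le.mp h).le
  have hy0 : 0 < y := ha.trans_le hy
  have hx0 : 0 < x := ha.trans_le hx
  rw [abs_of_nonneg (sub_nonneg.2 (log_le_log hy0 h)), abs_of_nonneg (sub_nonneg.2 h),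
    ← log_div hx0.ne' hy0.ne']
  calc log (x / y) ≤ x / y - 1 := log_le_sub_one_of_pos (div_pos hx0 hy0)
    _ = (x - y) / y := by field_simp
    _ ≤ (x - y) / a := div_le_div_of_nonneg_left (sub_nonneg.2 h) ha hy

section Density

variable {α : Type*} [MeasureSpace α] {Q : Measure α}

lemma dens_nonneg (x : α) : 0 ≤ dens Q x := ENNReal.toReal_nonneg

lemma measurable_dens : Measurable (dens Q) :=
  (Measure.measurable_rnDeriv Q volume).ennreal_toReal

lemma integrable_dens [IsFiniteMeasure Q] : Integrable (dens Q) :=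
  Measure.integrable_toReal_rnDeriv

variable [SigmaFinite (volume : Measure α)]

lemma integral_dens [IsProbabilityMeasure Q] (hac : Q ≪ volume) : ∫ x, dens Q x = 1 :=
  (Measure.integral_toReal_rnDeriv hac).trans probReal_univ

lemma dens_pos_ae [SigmaFinite Q] (hac : Q ≪ volume) : ∀ᵐ x ∂Q, 0 < dens Q x := by
  filter_upwards [Measure.rnDeriv_pos hac, hac.ae_le (Measure.rnDeriv_lt_top Q volume)] with x h h'
  exact ENNReal.toReal_pos h.ne' h'.ne

lemma integral_dens_mul [SigmaFinite Q] (hac : Q ≪ volume) (f : α → ℝ) :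
    ∫ x, dens Q x * f x = ∫ x, f x ∂Q :=
  integral_rnDeriv_smul hac

lemma integrable_dens_mul_iff [SigmaFinite Q] (hac : Q ≪ volume) {f : α → ℝ} :
    Integrable (fun x => dens Q x * f x) ↔ Integrable f Q :=
  integrable_rnDeriv_smul_iff hac

end Density

section Cube

variable {d : ℕ} {Q : Measure (Fin d → ℝ)} [IsProbabilityMeasure Q]

lemma ae_mem_cube (hmass : Q (Cube d) = 1) : ∀ᵐ x ∂Q, x ∈ Cube d :=
  (prob_compl_eq_zero_iff (measurableSet_cube d)).2 hmass

lemma dens_eq_zero_ae (hac : Q ≪ volume) (hmass : Q (Cube d) = 1) :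
    ∀ᵐ x : Fin d → ℝ, x ∉ Cube d → dens Q x = 0 := by
  have h := (prob_compl_eq_zero_iff (measurableSet_cube d)).2 hmass
  rw [← Measure.setLIntegral_rnDeriv hac,
    lintegral_eq_zero_iff (Measure.measurable_rnDeriv Q volume)] at h
  filter_upwards [(ae_restrict_iff' (measurableSet_cube d).compl).1 h] with x hx hxc
  simp [dens, hx hxc]

/-- Gibbs' inequality against an unnormalised positive density on the cube. -/
lemma diffEnt_le (hac : Q ≪ volume) (hmass : Q (Cube d) = 1) (hfin : FiniteEnt Q)
    {f : (Fin d → ℝ) → ℝ} (hpos : ∀ x, 0 < f x) (hf : IntegrableOn f (Cube d))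
    (hlog : Integrable (fun x => log (f x)) Q) :
    diffEnt Q ≤ (∫ x in Cube d, f x) - 1 - ∫ x, log (f x) ∂Q := by
  have hC := measurableSet_cube d
  have hlog' := (integrable_dens_mul_iff hac).2 hlog
  have hf' : Integrable ((Cube d).indicator f) := hf.integrable_indicator hC
  have hle : ∫ x, (dens Q x * log (f x) - dens Q x * log (dens Q x))
      ≤ ∫ x, ((Cube d).indicator f x - dens Q x) := by
    refine integral_mono_ae (hlog'.sub hfin) (hf'.sub integrable_dens) ?_
    filter_upwards [dens_eq_zero_ae hac hmass] with x hx
    by_cases hxC : x ∈ Cube d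
    · simpa [hxC] using mul_log_sub_mul_log_le (dens_nonneg x) (hpos x)
    · simp [hxC, hx hxC]
  rw [integral_sub hlog' hfin, integral_sub hf' integrable_dens, integral_dens hac,
    integral_dens_mul hac, integral_indicator hC] at hle
  rw [diffEnt]
  linarith

/-- The trivial bound: the uniform distribution maximises entropy on the cube. -/
lemma diffEnt_nonpos (hac : Q ≪ volume) (hmass : Q (Cube d) = 1) (hfin : FiniteEnt Q) :
    diffEnt Q ≤ 0 := by
  have h := diffEnt_le hac hmass hfin (f := fun _ => 1) (fun _ => one_pos)
    (integrableOn_const (volume_cube_lt_top d).ne) (by simp)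
  simpa [measureReal_def, volume_cube] using h

end Cube

lemma abs_log_clamp_le {t b : ℝ} (ht : 0 < t) (hb : 1 ≤ b) :
    |log (max (min t b) b⁻¹)| ≤ |log t| := by
  have hb' : b⁻¹ ≤ 1 := inv_le_one_of_one_le₀ hb
  have hb0 : 0 < b⁻¹ := inv_pos.2 (one_pos.trans_le hb)
  rcases le_total 1 t with h | h
  · have h1 : 1 ≤ max (min t b) b⁻¹ := le_max_of_le_left (le_min h hb)
    have h2 : max (min t b) b⁻¹ ≤ t := max_le (min_le_left _ _) (hb'.trans h)
    rw [abs_of_nonneg (log_nonneg h1), abs_of_nonneg (log_nonneg h)]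
    exact log_le_log (one_pos.trans_le h1) h2
  · rw [min_eq_left (h.trans hb)]
    have h1 : max t b⁻¹ ≤ 1 := max_le h hb'
    have h2 : t ≤ max t b⁻¹ := le_max_left _ _
    rw [abs_of_nonpos (log_nonpos (ht.trans_le h2).le h1), abs_of_nonpos (log_nonpos ht.le h)]
    exact neg_le_neg (log_le_log ht h2)

lemma integrable_log_of_mem_Icc {α : Type*} [MeasurableSpace α] {μ : Measure α}
    [IsFiniteMeasure μ] {f : α → ℝ} {a b : ℝ} (hf : AEStronglyMeasurable f μ) (ha : 0 < a)
    (hfa : ∀ x, a ≤ f x) (hfb : ∀ x, f x ≤ b) : Integrable (fun x => log (f x)) μ := by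
  refine .of_bound (hf.aemeasurable.log).aestronglyMeasurable (max |log a| |log b|)
    (ae_of_all _ fun x => ?_)
  exact abs_le_max_abs_abs (log_le_log ha (hfa x)) (log_le_log (ha.trans_le (hfa x)) (hfb x))

section Approximation

variable {d : ℕ} {P : Measure (Fin d → ℝ)} [IsProbabilityMeasure P]

lemma tendsto_integral_log_clamp_dens (hac : P ≪ volume) (hfin : FiniteEnt P) :
    Tendsto (fun n : ℕ => ∫ x, log (max (min (dens P x) (n + 1)) ((n : ℝ) + 1)⁻¹) ∂P)
      atTop (nhds (-diffEnt P)) := by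
  have hint : Integrable (fun x => log (dens P x)) P := (integrable_dens_mul_iff hac).1 hfin
  rw [diffEnt, neg_neg, integral_dens_mul hac]
  refine tendsto_integral_of_dominated_convergence (fun x => |log (dens P x)|) (fun n => ?_)
    hint.abs (fun n => ?_) ?_
  · exact (((measurable_dens.min measurable_const).max
      measurable_const).log).aestronglyMeasurable
  · filter_upwards [dens_pos_ae hac] with x hx
    exact abs_log_clamp_le hx (by linarith [n.cast_nonneg (α := ℝ)])
  · filter_upwards [dens_pos_ae hac] with x hx
    refine tendsto_const_nhds.congr' ?_
    filter_upwards [tendsto_natCast_atTop_atTop.eventually_ge_atTop (dens P x),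
      tendsto_natCast_atTop_atTop.eventually_ge_atTop (dens P x)⁻¹] with n h1 h2
    rw [min_eq_left (by linarith), max_eq_left (inv_le_of_inv_le₀ hx (by linarith))]

lemma setIntegral_clamp_dens_le (hac : P ≪ volume) {b : ℝ} (hb : 0 < b) :
    ∫ x in Cube d, max (min (dens P x) b) b⁻¹ ≤ 1 + b⁻¹ := by
  have hfinC : IsFiniteMeasure (volume.restrict (Cube d)) :=
    isFiniteMeasure_restrict.2 (volume_cube_lt_top d).ne
  have hi : IntegrableOn (fun x => dens P x + b⁻¹) (Cube d) :=
    integrable_dens.integrableOn.add (integrable_const _)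
  calc ∫ x in Cube d, max (min (dens P x) b) b⁻¹
      ≤ ∫ x in Cube d, (dens P x + b⁻¹) := by
        refine integral_mono_of_nonneg (ae_of_all _ fun x => ?_) hi (ae_of_all _ fun x => ?_)
        · exact le_max_of_le_right (inv_nonneg.2 hb.le)
        · exact max_le ((min_le_left _ _).trans (le_add_of_nonneg_right (inv_nonneg.2 hb.le)))
            (le_add_of_nonneg_left (dens_nonneg x))
    _ = (∫ x in Cube d, dens P x) + b⁻¹ := by
        rw [integral_add integrable_dens.integrableOn (integrable_const _)]
        simp [measureReal_def, volume_cube]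
    _ ≤ 1 + b⁻¹ := by
        rw [← integral_dens hac]
        exact add_le_add_left
          (setIntegral_le_integral integrable_dens (ae_of_all _ dens_nonneg)) _

/-- A density of finite entropy is approximated, in the sense needed for Gibbs' inequality to be
almost sharp, by continuous functions bounded away from `0` and `∞`. -/
lemma exists_continuous_near_dens (hac : P ≪ volume) (hfin : FiniteEnt P) {ε : ℝ} (hε : 0 < ε) :
    ∃ (f : (Fin d → ℝ) → ℝ) (a b : ℝ), Continuous f ∧ 0 < a ∧ (∀ x, a ≤ f x) ∧ (∀ x, f x ≤ b) ∧
      ∫ x in Cube d, f x ≤ 1 + ε ∧ -diffEnt P - ε ≤ ∫ x, log (f x) ∂P := by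
  have hfinC : IsFiniteMeasure (volume.restrict (Cube d)) :=
    isFiniteMeasure_restrict.2 (volume_cube_lt_top d).ne
  obtain ⟨n, hn1, hn2⟩ := (((tendsto_integral_log_clamp_dens hac hfin).eventually_const_lt
    (show -diffEnt P - ε / 2 < -diffEnt P by linarith)).and
    (tendsto_natCast_atTop_atTop.eventually_ge_atTop (ε / 2)⁻¹)).exists
  set b : ℝ := n + 1
  have hb1 : 1 ≤ b := by linarith [n.cast_nonneg (α := ℝ)]
  have hb0 : 0 < b := one_pos.trans_le hb1
  have ha0 : 0 < b⁻¹ := inv_pos.2 hb0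
  have ha1 : b⁻¹ ≤ 1 := inv_le_one_of_one_le₀ hb1
  have hbε : b⁻¹ ≤ ε / 2 := inv_le_of_inv_le₀ (half_pos hε) (by linarith)
  set g : (Fin d → ℝ) → ℝ := fun x => max (min (dens P x) b) b⁻¹
  have hgm : Measurable g := (measurable_dens.min measurable_const).max measurable_const
  have hga : ∀ x, b⁻¹ ≤ g x := fun x => le_max_right _ _
  have hgb : ∀ x, g x ≤ b := fun x => max_le (min_le_right _ _) (ha1.trans hb1)
  have hg1 : ∫ x in Cube d, g x ≤ 1 + b⁻¹ := setIntegral_clamp_dens_le hac hb0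
  have hgi : ∀ (ν : Measure (Fin d → ℝ)) [IsFiniteMeasure ν], Integrable g ν := fun ν _ =>
    .of_bound hgm.aestronglyMeasurable b
      (ae_of_all _ fun x => by rw [norm_of_nonneg (ha0.le.trans (hga x))]; exact hgb x)
  set μ : Measure (Fin d → ℝ) := volume.restrict (Cube d) + P
  obtain ⟨φ, hφ, hφi⟩ := (hgi μ).exists_boundedContinuous_integral_sub_le
    (show 0 < ε / 2 * b⁻¹ by positivity)
  set f : (Fin d → ℝ) → ℝ := fun x => max (φ x) b⁻¹
  have hfc : Continuous f := φ.continuous.max continuous_const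
  have hfa : ∀ x, b⁻¹ ≤ f x := fun x => le_max_right _ _
  have hfb : ∀ x, f x ≤ max ‖φ‖ b⁻¹ := fun x =>
    max_le_max_right _ ((le_abs_self _).trans (φ.norm_coe_le_norm x))
  have hfi : ∀ (ν : Measure (Fin d → ℝ)) [IsFiniteMeasure ν], Integrable f ν := fun ν _ =>
    .of_bound hfc.aestronglyMeasurable (max ‖φ‖ b⁻¹)
      (ae_of_all _ fun x => by rw [norm_of_nonneg (ha0.le.trans (hfa x))]; exact hfb x)
  have hdist : ∀ ν ≤ μ, ∫ x, |g x - f x| ∂ν ≤ ε / 2 * b⁻¹ := fun ν hν => by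
    refine le_trans (le_trans (integral_mono_measure hν (ae_of_all _ fun x => abs_nonneg _)
      ((hgi μ).sub (hfi μ)).abs) (integral_mono ((hgi μ).sub (hfi μ)).abs
      ((hgi μ).sub hφi).norm fun x => ?_)) hφ
    simpa [f, max_eq_left (hga x)] using abs_max_sub_max_le_abs (g x) (φ x) b⁻¹
  refine ⟨f, b⁻¹, max ‖φ‖ b⁻¹, hfc, ha0, hfa, hfb, ?_, ?_⟩
  · have h1 := hdist _ (Measure.le_add_right le_rfl : volume.restrict (Cube d) ≤ μ)
    have h2 : ∫ x in Cube d, (f x - g x) ≤ ∫ x in Cube d, |g x - f x| :=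
      integral_mono ((hfi _).sub (hgi _)) ((hgi _).sub (hfi _)).abs
        fun x => (le_abs_self _).trans (abs_sub_comm _ _).le
    rw [integral_sub (hfi _) (hgi _)] at h2
    have h3 : ε / 2 * b⁻¹ ≤ ε / 2 := mul_le_of_le_one_right (half_pos hε).le ha1
    linarith
  · have h1 := hdist _ (Measure.le_add_left le_rfl : P ≤ μ)
    have hlogg : Integrable (fun x => log (g x)) P :=
      integrable_log_of_mem_Icc hgm.aestronglyMeasurable ha0 hga hgb
    have hlogf : Integrable (fun x => log (f x)) P :=
      integrable_log_of_mem_Icc hfc.aestronglyMeasurable ha0 hfa hfb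
    have h2 : ∫ x, (log (g x) - log (f x)) ∂P ≤ ∫ x, |g x - f x| / b⁻¹ ∂P :=
      integral_mono (hlogg.sub hlogf) (((hgi P).sub (hfi P)).abs.div_const _)
        fun x => (le_abs_self _).trans (abs_log_sub_log_le ha0 (hga x) (hfa x))
    rw [integral_sub hlogg hlogf, integral_div] at h2
    have h3 : (∫ x, |g x - f x| ∂P) / b⁻¹ ≤ ε / 2 := (div_le_iff₀ ha0).2 h1
    linarith

end Approximation

section Moments

variable {d r : ℕ} {ψ : (Fin d → ℝ) → Fin r → ℝ}

lemma integrable_coord {Q : Measure (Fin d → ℝ)} [IsProbabilityMeasure Q]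
    (hmass : Q (Cube d) = 1) (hψc : Continuous ψ)
    (hψb : ∃ C, ∀ u ∈ Cube d, ∀ j, |ψ u j| ≤ C) (j : Fin r) :
    Integrable (fun u => ψ u j) Q := by
  obtain ⟨C, hC⟩ := hψb
  refine .of_bound (by fun_prop) C ?_
  filter_upwards [ae_mem_cube hmass] with u hu using hC u hu j

/-- Two distributions with equal `ψ`-moments nearly agree on functions uniformly close to the span
of `ψ`. -/
lemma integral_le_of_moments_eq {P Q : Measure (Fin d → ℝ)} [IsProbabilityMeasure P]
    [IsProbabilityMeasure Q] (hP : P (Cube d) = 1) (hQ : Q (Cube d) = 1) (hψc : Continuous ψ)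
    (hψb : ∃ C, ∀ u ∈ Cube d, ∀ j, |ψ u j| ≤ C)
    (hmom : ∀ j, ∫ u, ψ u j ∂Q = ∫ u, ψ u j ∂P) {g : (Fin d → ℝ) → ℝ} {θ : Fin r → ℝ} {δ : ℝ}
    (hgP : Integrable g P) (hgQ : Integrable g Q)
    (hg : ∀ u ∈ Cube d, |g u - ∑ j, θ j * ψ u j| ≤ δ) :
    ∫ u, g u ∂P ≤ ∫ u, g u ∂Q + 2 * δ := by
  have hi : ∀ (ν : Measure (Fin d → ℝ)) [IsProbabilityMeasure ν], ν (Cube d) = 1 →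
      ∀ j ∈ Finset.univ, Integrable (fun u => θ j * ψ u j) ν :=
    fun ν _ hν j _ => (integrable_coord hν hψc hψb j).const_mul _
  have hclose : ∀ (ν : Measure (Fin d → ℝ)) [IsProbabilityMeasure ν], ν (Cube d) = 1 →
      Integrable g ν → |∫ u, g u ∂ν - ∑ j, θ j * ∫ u, ψ u j ∂ν| ≤ δ := by
    intro ν _ hν hgν
    have hsum : ∑ j, θ j * ∫ u, ψ u j ∂ν = ∫ u, ∑ j, θ j * ψ u j ∂ν := by
      rw [integral_finsetSum _ (hi ν hν)]
      simp_rw [integral_const_mul]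
    rw [hsum, ← integral_sub hgν (integrable_finsetSum _ (hi ν hν)), ← norm_eq_abs]
    have h := norm_integral_le_of_norm_le_const (μ := ν) (C := δ)
      (f := fun u => g u - ∑ j, θ j * ψ u j)
      ((ae_mem_cube hν).mono fun u hu => hg u hu)
    simpa using h
  have h1 := (abs_le.1 (hclose P hP hgP)).2
  have h2 := (abs_le.1 (hclose Q hQ hgQ)).1
  simp_rw [hmom] at h2
  linarith

end Moments

/-- Theorem `fund` (B): if the constraint functions `ψ_m` are nested and universally
approximating on `[0,1]^d`, the value of the maximum-entropy problem under the constraints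
`E[ψ_m] = E_{P*}[ψ_m]` converges to the differential entropy of `P*`. -/
theorem maxent_value_tendsto_entropy {d : ℕ}
    (Pstar : Measure (Fin d → ℝ)) [IsProbabilityMeasure Pstar]
    (hPac : Pstar ≪ volume) (hPmass : Pstar (Cube d) = 1) (hPfin : FiniteEnt Pstar)
    (r : ℕ → ℕ) (hr : ∀ m, 0 < r m)
    (ψ : (m : ℕ) → (Fin d → ℝ) → Fin (r m) → ℝ)
    (hψc : ∀ m, Continuous (ψ m))
    (hψb : ∀ m, ∃ C, ∀ u ∈ Cube d, ∀ j, |ψ m u j| ≤ C)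
    (hψ1 : ∀ m u, ψ m u ⟨0, hr m⟩ = 1)
    (hnest : ∀ m, ∃ ι : Fin (r m) → Fin (r (m + 1)),
      ∀ u j, ψ (m + 1) u (ι j) = ψ m u j)
    (hdense : ∀ g : (Fin d → ℝ) → ℝ, ContinuousOn g (Cube d) → ∀ ε : ℝ, 0 < ε →
      ∃ (m : ℕ) (θ : Fin (r m) → ℝ), ∀ u ∈ Cube d, |g u - ∑ j, θ j * ψ m u j| ≤ ε) :
    Tendsto (fun m : ℕ =>
        sSup {x : ℝ | ∃ Q : Measure (Fin d → ℝ), IsProbabilityMeasure Q ∧ Q ≪ volume ∧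
          Q (Cube d) = 1 ∧
          (∀ j, ∫ u, ψ m u j ∂Q = ∫ u, ψ m u j ∂Pstar) ∧
          FiniteEnt Q ∧ diffEnt Q = x})
      atTop (nhds (diffEnt Pstar)) := by
  set S : ℕ → Set ℝ := fun m => {x : ℝ | ∃ Q : Measure (Fin d → ℝ), IsProbabilityMeasure Q ∧
    Q ≪ volume ∧ Q (Cube d) = 1 ∧ (∀ j, ∫ u, ψ m u j ∂Q = ∫ u, ψ m u j ∂Pstar) ∧
    FiniteEnt Q ∧ diffEnt Q = x}
  have hmem : ∀ m, diffEnt Pstar ∈ S m := fun m =>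
    ⟨Pstar, inferInstance, hPac, hPmass, fun _ => rfl, hPfin, rfl⟩
  have hbdd : ∀ m, BddAbove (S m) := fun m => ⟨0, by
    rintro _ ⟨Q, hQ, hac, hmass, -, hfin, rfl⟩
    exact diffEnt_nonpos hac hmass hfin⟩
  have hanti : Antitone S := antitone_nat_of_succ_le fun m => by
    rintro _ ⟨Q, hQ, hac, hmass, hmom, hfin, rfl⟩
    obtain ⟨ι, hι⟩ := hnest m
    exact ⟨Q, hQ, hac, hmass, fun j => by simpa only [hι] using hmom (ι j), hfin, rfl⟩
  rw [Metric.tendsto_atTop]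
  intro ε hε
  obtain ⟨f, a, b, hfc, ha, hfa, hfb, hf1, hf2⟩ :=
    exists_continuous_near_dens hPac hPfin (show 0 < ε / 8 by positivity)
  have hpos : ∀ x, 0 < f x := fun x => ha.trans_le (hfa x)
  obtain ⟨M, θ, hθ⟩ := hdense (fun x => log (f x))
    (hfc.log fun x => (hpos x).ne').continuousOn (ε / 8) (by positivity)
  have hub : ∀ x ∈ S M, x ≤ diffEnt Pstar + ε / 2 := by
    rintro _ ⟨Q, hQ, hac, hmass, hmom, hfin, rfl⟩
    have hlog : ∀ (R : Measure (Fin d → ℝ)) [IsProbabilityMeasure R],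
        Integrable (fun x => log (f x)) R := fun R _ =>
      integrable_log_of_mem_Icc hfc.aestronglyMeasurable ha hfa hfb
    have h1 := diffEnt_le hac hmass hfin hpos
      (hfc.continuousOn.integrableOn_compact (isCompact_univ_pi fun _ => isCompact_Icc)) (hlog Q)
    have h2 := integral_le_of_moments_eq hPmass hmass (hψc M) (hψb M) hmom (hlog Pstar) (hlog Q) hθ
    linarith
  refine ⟨M, fun m hm => ?_⟩
  have h1 : diffEnt Pstar ≤ sSup (S m) := le_csSup (hbdd m) (hmem m)
  have h2 : sSup (S m) ≤ diffEnt Pstar + ε / 2 :=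
    csSup_le ⟨_, hmem m⟩ fun x hx => hub x (hanti hm hx)
  rw [dist_eq, abs_lt]
  constructor <;> linarith
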